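/- The plethysm h_k ∘ h₂ equals the sum of Schur functions s_{2α} over all partitions α of k, where 2α = (2α₁, 2α₂, …). -/

import Mathlib

open MvPolynomial Finset

/-- The ring of symmetric functions (with rational coefficients), realized as the free
commutative `ℚ`-algebra on the complete homogeneous symmetric functions `h₁, h₂, …`,
where the variable `n : ℕ` corresponds to `h_{n+1}`. -/
abbrev SymFn : Type := MvPolynomial ℕ ℚ

/-- The complete homogeneous symmetric function `h_n`, with `h_n = 0` for `n < 0`
and `h_0 = 1`. -/
noncomputable def hh (n : ℤ) : SymFn :=
  if n < 0 then 0 else if n = 0 then 1 else MvPolynomial.X (n.toNat - 1)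

/-- The power sum symmetric functions, defined from the `h`'s by Newton's identities:
`p_k = k h_k - ∑_{i=1}^{k-1} h_i p_{k-i}`. -/
noncomputable def pp : ℕ → SymFn
  | 0 => 0
  | (k+1) => ((k : ℚ) + 1) • hh (k+1) - ∑ i ∈ Finset.range k, hh (i+1) * pp (k - i)
  decreasing_by exact Nat.lt_succ_of_le (Nat.sub_le _ _)

/-- `h_m` written as a polynomial in the power sums (the variable `j` stands for `p_{j+1}`),
via the recursion `m h_m = ∑_{i=1}^{m} p_i h_{m-i}`. -/
noncomputable def hInP : ℕ → MvPolynomial ℕ ℚ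
  | 0 => 1
  | (m+1) => ((m : ℚ) + 1)⁻¹ •
      ∑ i ∈ Finset.range (m+1), MvPolynomial.X i * hInP (m - i)
  decreasing_by exact Nat.lt_succ_of_le (Nat.sub_le _ _)

/-- The `k`-th Adams operation: the algebra endomorphism of `SymFn` determined by
`p_m ↦ p_{k m}` on power sums. -/
noncomputable def adams (k : ℕ) : SymFn →ₐ[ℚ] SymFn :=
  aeval fun m => (aeval fun j => pp (k * (j+1))) (hInP (m+1))

/-- The plethysm `h_k ∘ g`, via the recursion
`k (h_k ∘ g) = ∑_{i=1}^{k} (p_i ∘ g) (h_{k-i} ∘ g)`, where `p_i ∘ g = adams i g`. -/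
noncomputable def hPleth (g : SymFn) : ℕ → SymFn
  | 0 => 1
  | (k+1) => ((k : ℚ) + 1)⁻¹ •
      ∑ i ∈ Finset.range (k+1), adams (i+1) g * hPleth g (k - i)
  decreasing_by exact Nat.lt_succ_of_le (Nat.sub_le _ _)

/-- The (outer) plethysm `f ∘ g` of symmetric functions: the algebra homomorphism
in the left argument sending `h_k ↦ h_k ∘ g`. -/
noncomputable def pleth (f g : SymFn) : SymFn := aeval (fun m => hPleth g (m+1)) f

/-- The elementary symmetric functions, via `e_k = ∑_{i=1}^{k} (-1)^{i-1} h_i e_{k-i}`. -/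
noncomputable def ee : ℕ → SymFn
  | 0 => 1
  | (k+1) => ∑ i ∈ Finset.range (k+1), ((-1 : ℚ))^i • (hh (i+1) * ee (k - i))
  decreasing_by exact Nat.lt_succ_of_le (Nat.sub_le _ _)

/-- The parts of a multiset, as a weakly decreasing list. -/
def sortedParts (m : Multiset ℕ) : List ℕ := (m.sort (· ≤ ·)).reverse

/-- The Schur function `s_m`, via the Jacobi–Trudi determinant
`s_λ = det (h_{λ_i + j - i})`. -/
noncomputable def schur (m : Multiset ℕ) : SymFn :=
  Matrix.det (Matrix.of fun i j : Fin (Multiset.card m) =>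
    hh (((sortedParts m).getD i 0 : ℤ) + (j : ℤ) - (i : ℤ)))

/-- A multiset of naturals is a partition when all its parts are positive. -/
def IsPartition (m : Multiset ℕ) : Prop := 0 ∉ m

/-- A strict partition: positive, pairwise distinct parts. -/
def IsStrictPartition (m : Multiset ℕ) : Prop := 0 ∉ m ∧ m.Nodup

/-- The first (largest) part `λ₁` of a partition. -/
def firstPart (m : Multiset ℕ) : ℕ := m.sup

/-- The size `|λ|` of a partition. -/
def psize (m : Multiset ℕ) : ℕ := m.sum

/-- The conjugate (transposed) partition. -/
def conj (m : Multiset ℕ) : Multiset ℕ :=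
  ((List.range m.sup).map fun i => Multiset.card (m.filter fun x => i < x) : List ℕ)

/-- The partition `ν[N] = (N - |ν|, ν₁, ν₂, …)` (valid when `N ≥ |ν| + ν₁`). -/
def padded (ν : Multiset ℕ) (N : ℕ) : Multiset ℕ := (N - ν.sum) ::ₘ ν

/-- `c` is the expansion of `f` in the basis of Schur functions indexed by partitions. -/
def SchurExpansion (f : SymFn) (c : Multiset ℕ →₀ ℚ) : Prop :=
  (∀ κ ∈ c.support, IsPartition κ) ∧ f = c.sum fun κ a => a • schur κ

/-- `Φ` of a Schur expansion: the largest first part of a partition occurring in it. -/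
def Phi (c : Multiset ℕ →₀ ℚ) : ℕ := c.support.sup firstPart

/-- The partition `2α`, doubling every part. -/
def double (m : Multiset ℕ) : Multiset ℕ := m.map (2 * ·)

/-- For a strict partition `β = (β₁ > β₂ > … > β_r > 0)`, the partition `Γ(β)` with
Frobenius coordinates `(β₁ - 1, …, β_r - 1 | β₁, …, β_r)`. -/
def gammaFrob (β : Multiset ℕ) : Multiset ℕ :=
  let b := sortedParts β
  let r := b.length
  (((List.range r).map fun i => b.getD i 0 + i)
    ++ ((List.range (b.getD 0 0 + 1 - r)).map fun t =>
        ((List.range r).filter fun j => r + t ≤ b.getD j 0 + j).length) : List ℕ)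


section PartOne

/-- Generalized Jacobi–Trudi determinant. -/
noncomputable def JT {R : Type*} [CommRing R] (a : ℤ → R) {n : ℕ} (l : Fin n → ℤ) : R :=
  Matrix.det (Matrix.of fun i j : Fin n => a (l i + (j : ℤ) - (i : ℤ)))

/-- Indicator vector. -/
def indS {n : ℕ} (S : Finset (Fin n)) (i : Fin n) : ℕ := if i ∈ S then 1 else 0

lemma indS_sum {n : ℕ} (S : Finset (Fin n)) : ∑ i, indS S i = S.card := by
  simp [indS]

lemma det_add_expand {R : Type*} [CommRing R] {n : ℕ} (u : R) (X Y : Fin n → Fin n → R) :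
    Matrix.det (Matrix.of fun i j => X i j + u * Y i j) =
      ∑ S : Finset (Fin n), u ^ S.card *
        Matrix.det (Matrix.of fun i j => if i ∈ S then Y i j else X i j) := by
  have h := MultilinearMap.map_add_univ
    ((Matrix.detRowAlternating (n := Fin n) (R := R)).toMultilinearMap)
    (fun i j => u * Y i j) X
  have h1 : (Matrix.of fun i j => X i j + u * Y i j) = ((fun i j => u * Y i j) + X) := by
    funext i j
    simp [add_comm]
  rw [h1]
  refine h.trans (Finset.sum_congr rfl fun S _ => ?_)
  have h2 := Matrix.det_mul_column (fun i => if i ∈ S then u else 1)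
    (Matrix.of fun i j => if i ∈ S then Y i j else X i j)
  have h3 : (∏ i, (if i ∈ S then u else 1)) = u ^ S.card := by
    rw [Finset.prod_ite_mem]; simp
  rw [h3] at h2
  rw [← h2]
  change Matrix.det _ = Matrix.det _
  congr 1
  funext i j
  by_cases hi : i ∈ S <;> simp [Finset.piecewise, hi]

lemma JT_skew {R : Type*} [CommRing R] (a : ℤ → R) (u : R) {n : ℕ} (l : Fin n → ℤ) :
    JT (fun m => a m + u * a (m - 1)) l =
      ∑ S : Finset (Fin n), u ^ S.card * JT a (fun i => l i - (indS S i : ℤ)) := by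
  unfold JT
  rw [det_add_expand u (fun i j => a (l i + j - i)) (fun i j => a (l i + j - i - 1))]
  refine Finset.sum_congr rfl fun S _ => ?_
  congr 3
  funext i j
  by_cases hi : i ∈ S
  · simp only [indS, hi, if_true]; congr 1; push_cast; ring
  · simp only [indS, hi, if_false]; congr 1; push_cast; ring

lemma JT_up {R : Type*} [CommRing R] (a : ℤ → R) {n : ℕ} (l : Fin n → ℤ) :
    Matrix.det (Matrix.of fun i j : Fin n =>
        a (l i + (j : ℤ) - (i : ℤ)) + a (l i + 1 + (j : ℤ) - (i : ℤ))) =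
      ∑ S : Finset (Fin n), JT a (fun i => l i + (indS S i : ℤ)) := by
  have := det_add_expand (1 : R) (fun i j => a (l i + (j : ℤ) - (i : ℤ)))
    (fun i j => a (l i + 1 + (j : ℤ) - (i : ℤ)))
  simp only [one_mul, one_pow] at this
  rw [this]
  refine Finset.sum_congr rfl fun S _ => ?_
  unfold JT
  congr 2
  funext i j
  by_cases hi : i ∈ S
  · simp only [indS, hi, if_true]; congr 1
  · simp only [indS, hi, if_false]; congr 1; push_cast; ring

lemma telescope {R : Type*} [CommRing R] (y : ℕ → R) (b : ℤ → R) (v : ℤ) (m : ℕ) :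
    ∑ c ∈ range m, y c * (b (v - c) + b (v + 1 - c)) =
      y 0 * b (v + 1) + ∑ c ∈ range m, (y c + y (c + 1)) * b (v - c) - y m * b (v + 1 - m) := by
  induction m with
  | zero => simp
  | succ m ih =>
    rw [Finset.sum_range_succ, Finset.sum_range_succ, ih]
    have : v + 1 - ((m + 1 : ℕ) : ℤ) = v - m := by push_cast; ring
    rw [this]; ring

lemma det_shift {R : Type*} [CommRing R] (b : ℤ → R) (ε : ℕ → R) (n : ℕ)
    (hε : ε 0 = 1) (v : Fin (n + 1) → ℤ) (r : Fin (n + 1) → R)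
    (hr : ∀ i, b (v i + 1) = ∑ c ∈ range (n + 1), (-1) ^ c * ε (c + 1) * b (v i - c) + r i) :
    Matrix.det (Matrix.of fun i c : Fin (n + 1) => b (v i - c) + b (v i + 1 - c)) =
      (∑ k ∈ range (n + 2), ε k) * Matrix.det (Matrix.of fun i c : Fin (n + 1) => b (v i - c)) +
      Matrix.det (Matrix.updateCol
        (Matrix.of fun i c : Fin (n + 1) => b (v i - c) + b (v i + 1 - c)) 0 r) := by
  set M : Matrix (Fin (n + 1)) (Fin (n + 1)) R :=
    Matrix.of fun i c : Fin (n + 1) => b (v i - c) + b (v i + 1 - c) with hM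
  set E := ∑ k ∈ range (n + 2), ε k with hE
  let y : ℕ → R := fun c => (-1) ^ (c + 1) * (E - ∑ k ∈ range (c + 1), ε k)
  let x : Fin (n + 1) → R := fun c => y c + if c = 0 then E else 0
  have hx0 : x 0 = 1 := by simp [x, y, hε]
  have hMx : M.mulVec x = E • (fun i => b (v i)) + r := by
    funext i
    have h1 : ∑ c : Fin (n + 1), M i c * y c =
        ∑ c ∈ range (n + 1), y c * (b (v i - c) + b (v i + 1 - c)) := by
      rw [← Fin.sum_univ_eq_sum_range (fun c => y c * (b (v i - c) + b (v i + 1 - c)))]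
      refine Finset.sum_congr rfl fun c _ => ?_
      simp [hM, mul_comm]
    rw [telescope] at h1
    have hy : ∀ c, y c + y (c + 1) = - ((-1) ^ c * ε (c + 1)) := by
      intro c
      simp only [y]
      rw [Finset.sum_range_succ _ (c + 1)]
      ring
    have hyn : y (n + 1) = 0 := by simp [y, hE]
    have hy0 : y 0 = 1 - E := by simp [y, hε]
    simp only [hy, hyn, hy0] at h1
    have h2 : ∑ c : Fin (n + 1), M i c * (if c = 0 then E else 0) =
        (b (v i) + b (v i + 1)) * E := by
      simp [hM]
    simp only [Matrix.mulVec, dotProduct, x, mul_add, Finset.sum_add_distrib, h1, h2]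
    simp only [Pi.add_apply, Pi.smul_apply, smul_eq_mul]
    rw [hr i]
    simp only [neg_mul, Finset.sum_neg_distrib]
    ring
  have hc : (M.updateCol 0 (M.mulVec x)).det = M.det := by
    rw [← Matrix.cramer_apply, Matrix.cramer_eq_adjugate_mulVec, Matrix.mulVec_mulVec,
      Matrix.adjugate_mul]
    simp [Matrix.smul_mulVec, hx0]
  rw [← hc, hMx, Matrix.det_updateCol_add, Matrix.det_updateCol_smul]
  congr 2
  symm
  refine Matrix.det_eq_of_forall_col_eq_smul_add_pred (fun _ => -1) ?_ ?_
  · intro i; simp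
  · intro i j
    rw [Matrix.updateCol_ne (Fin.succ_ne_zero j)]
    simp only [hM, Matrix.of_apply, Fin.val_succ, Fin.val_castSucc]
    have : v i + 1 - ((j.val + 1 : ℕ) : ℤ) = v i - (j.val : ℤ) := by push_cast; ring
    rw [this]; ring

lemma JT_rev {R : Type*} [CommRing R] (f : ℤ → R) {n : ℕ} (l : Fin (n + 1) → ℤ) :
    Matrix.det (Matrix.of fun i j : Fin (n + 1) => f (l i + (j : ℤ) - (i : ℤ))) =
    Matrix.det (Matrix.of fun i c : Fin (n + 1) => f ((l i.rev + (i : ℤ)) - (c : ℤ))) := by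
  rw [← Matrix.det_submatrix_equiv_self (Fin.revPerm)]
  congr 1
  funext i j
  simp only [Matrix.submatrix_apply, Matrix.of_apply, Fin.revPerm_apply]
  congr 1
  have hi := i.2
  have hj := j.2
  rw [Fin.val_rev, Fin.val_rev]
  omega

open Polynomial in
/-- grading by a polynomial variable -/
noncomputable def qs {R : Type*} [CommRing R] (a : ℤ → R) (m : ℤ) : R[X] :=
  Polynomial.X ^ m.toNat * Polynomial.C (a m)

open Polynomial in
lemma JT_scale {R : Type*} [CommRing R] (a : ℤ → R) (ha : ∀ m < 0, a m = 0) {n : ℕ}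
    (l : Fin n → ℕ) :
    JT (qs a) (fun i => (l i : ℤ)) =
      Polynomial.X ^ (∑ i, l i) * Polynomial.C (JT a (fun i => (l i : ℤ))) := by
  unfold JT
  rw [Matrix.det_apply, Matrix.det_apply, map_sum, Finset.mul_sum]
  refine Finset.sum_congr rfl fun σ _ => ?_
  rw [Units.smul_def, Units.smul_def, zsmul_eq_mul, zsmul_eq_mul, map_mul, map_prod, map_intCast]
  rw [mul_left_comm]
  congr 1
  simp only [Matrix.of_apply, qs, Finset.prod_mul_distrib]
  by_cases h : ∃ i, (l (σ i) : ℤ) + (i : ℤ) - (σ i : ℤ) < 0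
  · obtain ⟨i, hi⟩ := h
    have : ∏ i, (Polynomial.C (a ((l (σ i) : ℤ) + (i : ℤ) - (σ i : ℤ)))) = 0 :=
      Finset.prod_eq_zero (Finset.mem_univ i) (by rw [ha _ hi, map_zero])
    rw [this]; simp
  · push Not at h
    congr 1
    rw [Finset.prod_pow_eq_pow_sum]
    congr 1
    zify
    have h1 : ∀ i, (((l (σ i) : ℤ) + (i : ℤ) - (σ i : ℤ)).toNat : ℤ) =
        (l (σ i) : ℤ) + (i : ℤ) - (σ i : ℤ) := fun i => Int.toNat_of_nonneg (h i)
    simp only [h1, Finset.sum_sub_distrib, Finset.sum_add_distrib]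
    rw [Equiv.sum_comp σ (fun i => (l i : ℤ)), Equiv.sum_comp σ (fun i => ((i : ℕ) : ℤ))]
    ring

open Polynomial in
lemma pieri {R : Type*} [CommRing R] (a : ℤ → R) (e : ℕ → R) (ha : ∀ m < 0, a m = 0)
    (he0 : e 0 = 1)
    (hrec : ∀ m : ℕ, a (m + 1) = ∑ c ∈ range (m + 1), (-1) ^ c * e (c + 1) * a (m - c))
    {n : ℕ} (l : Fin (n + 1) → ℕ) (j : ℕ) (hj : (∑ i, l i) + j ≤ n + 1) :
    ∑ S ∈ (Finset.univ : Finset (Finset (Fin (n + 1)))) with S.card = j,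
        JT a (fun i => (l i : ℤ) + (indS S i : ℤ)) = e j * JT a (fun i => (l i : ℤ)) := by
  have hup := JT_up (qs a) (fun i : Fin (n + 1) => (l i : ℤ))
  have hrev := JT_rev (fun m => qs a m + qs a (m + 1)) (fun i : Fin (n + 1) => (l i : ℤ))
  have hrev' := JT_rev (qs a) (fun i : Fin (n + 1) => (l i : ℤ))
  let v : Fin (n + 1) → ℤ := fun i => (l i.rev : ℤ) + (i : ℤ)
  let ε : ℕ → R[X] := fun k => Polynomial.X ^ k * Polynomial.C (e k)
  have hrec' : ∀ m N : ℕ, m + 1 ≤ N → qs a (m + 1) =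
      ∑ c ∈ range N, (-1) ^ c * ε (c + 1) * qs a (m - c) := by
    intro m N hN
    have h1 : ∑ c ∈ range N, (-1) ^ c * ε (c + 1) * qs a (m - c) =
        ∑ c ∈ range (m + 1), (-1) ^ c * ε (c + 1) * qs a (m - c) := by
      symm
      apply Finset.sum_subset
      · intro c; simp only [Finset.mem_range]; omega
      · intro c _ hc
        simp only [Finset.mem_range] at hc
        rw [qs, ha _ (by omega)]; simp
    rw [h1, qs, hrec, map_sum, Finset.mul_sum]
    refine Finset.sum_congr rfl fun c hc => ?_
    simp only [Finset.mem_range] at hc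
    have h2 : ((m : ℤ) + 1).toNat = (c + 1) + ((m : ℤ) - c).toNat := by omega
    simp only [qs, ε, h2, pow_add, map_mul, map_pow, map_neg, map_one]
    ring
  let N := ∑ i, l i + n + 1
  let r' : Fin (n + 1) → R[X] := fun i =>
    ∑ c ∈ Finset.Ico (n + 1) (N + 1), (-1) ^ c * (Polynomial.X ^ (c - (n + 1)) *
      Polynomial.C (e (c + 1))) * qs a (v i - c)
  have hd := det_shift (qs a) ε n (by simp [ε, he0]) v
    ((Polynomial.X ^ (n + 2) : R[X]) • r') (by
    intro i
    have hv : v i = ((l i.rev + i : ℕ) : ℤ) := by simp [v]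
    have hle : l i.rev ≤ ∑ i, l i := Finset.single_le_sum (fun _ _ => Nat.zero_le _) (Finset.mem_univ _)
    have hi := i.2
    rw [hv, hrec' _ (N + 1) (by simp only [N]; omega), ← hv]
    rw [Finset.range_eq_Ico, Finset.range_eq_Ico,
      ← Finset.sum_Ico_consecutive _ (Nat.zero_le (n + 1)) (by simp only [N]; omega)]
    congr 1
    simp only [Pi.smul_apply, r', smul_eq_mul, Finset.mul_sum]
    refine Finset.sum_congr rfl fun c hc => ?_
    rw [Finset.mem_Ico] at hc
    have : c + 1 = (n + 2) + (c - (n + 1)) := by omega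
    simp only [ε]
    conv_lhs => rw [show (Polynomial.X : R[X]) ^ (c + 1) = Polynomial.X ^ (n + 2) * Polynomial.X ^ (c - (n + 1)) by
      rw [← pow_add]; congr 1]
    ring)
  rw [Matrix.det_updateCol_smul] at hd
  have key : ∑ S : Finset (Fin (n + 1)), (Polynomial.X ^ ((∑ i, l i) + S.card) *
      Polynomial.C (JT a (fun i => (l i : ℤ) + (indS S i : ℤ))) : R[X]) =
      (∑ k ∈ range (n + 2), ε k) * (Polynomial.X ^ (∑ i, l i) * Polynomial.C (JT a (fun i => (l i : ℤ)))) +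
      Polynomial.X ^ (n + 2) * (Matrix.updateCol
        (Matrix.of fun i c : Fin (n + 1) => qs a (v i - c) + qs a (v i + 1 - c)) 0 r').det := by
    rw [← JT_scale a ha, JT, hrev', ← hd]
    have e1 : ∀ S : Finset (Fin (n + 1)), (Polynomial.X ^ ((∑ i, l i) + S.card) *
      Polynomial.C (JT a (fun i => (l i : ℤ) + (indS S i : ℤ))) : R[X]) =
        JT (qs a) (fun i => (l i : ℤ) + (indS S i : ℤ)) := by
      intro S
      have := JT_scale a ha (fun i => l i + indS S i)
      push_cast at this
      rw [this, Finset.sum_add_distrib, indS_sum]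
    simp only [e1]
    rw [← hup]
    have e2 : ∀ i j : Fin (n + 1), (l i : ℤ) + 1 + (j : ℤ) - (i : ℤ) =
      ((l i : ℤ) + (j : ℤ) - (i : ℤ)) + 1 := by intros; ring
    simp only [e2]
    rw [hrev]
    congr 2
    funext i c
    simp only [v]
    congr 2
    ring
  have hcoef := congrArg (fun p => Polynomial.coeff p ((∑ i, l i) + j)) key
  simp only [Polynomial.finsetSum_coeff, Polynomial.coeff_add] at hcoef
  rw [Polynomial.coeff_X_pow_mul', if_neg (by omega), add_zero] at hcoef
  rw [Finset.sum_filter]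
  convert hcoef using 1
  · refine Finset.sum_congr rfl fun S _ => ?_
    rw [Polynomial.coeff_X_pow_mul', Polynomial.coeff_C]
    by_cases h : S.card = j
    · rw [if_pos h, if_pos (by omega), if_pos (by omega)]
    · rw [if_neg h]
      split_ifs with h1 h2
      · omega
      · rfl
      · rfl
  · rw [mul_left_comm, add_comm (∑ i, l i) j, Polynomial.coeff_X_pow_mul, Polynomial.coeff_mul_C]
    congr 1
    simp only [ε, Polynomial.finsetSum_coeff]
    rw [Finset.sum_eq_single j]
    · simp
    · intro b _ hb
      rw [Polynomial.coeff_X_pow_mul', Polynomial.coeff_C]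
      split_ifs with h1 h2
      · omega
      · rfl
      · rfl
    · intro h; simp at h; omega

end PartOne

section PartTwo

/-- Weakly decreasing vectors with given sum. -/
def PV (n k : ℕ) : Finset (Fin n → ℕ) := by
  classical
  exact (Finset.piAntidiag Finset.univ k).filter Antitone

lemma mem_PV {n k : ℕ} {v : Fin n → ℕ} : v ∈ PV n k ↔ (∑ i, v i = k) ∧ Antitone v := by
  simp [PV]

lemma JT_zero_adj {R : Type*} [CommRing R] (a : ℤ → R) {n : ℕ} (l : Fin (n + 1) → ℤ) (i : Fin n)
    (h : l i.castSucc + 1 = l i.succ) : JT a l = 0 := by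
  unfold JT
  refine Matrix.det_zero_of_row_eq (i := i.castSucc) (j := i.succ) ?_ ?_
  · exact (Fin.castSucc_lt_succ (i := i)).ne
  · funext j
    simp only [Matrix.of_apply, ← h, Fin.val_succ, Fin.val_castSucc]
    congr 1
    push_cast
    ring

lemma JT_zero_last {R : Type*} [CommRing R] (a : ℤ → R) (ha : ∀ m < 0, a m = 0) {n : ℕ}
    (l : Fin (n + 1) → ℤ) (h : l (Fin.last n) < 0) : JT a l = 0 := by
  unfold JT
  refine Matrix.det_eq_zero_of_row_eq_zero (Fin.last n) fun j => ?_
  simp only [Matrix.of_apply, Fin.val_last]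
  apply ha
  have := j.2
  omega

lemma bij_S {R : Type*} [CommRing R] (a : ℤ → R) (ha : ∀ m < 0, a m = 0) {n : ℕ} (k : ℕ)
    (S : Finset (Fin (n + 1))) :
    ∑ α ∈ PV (n + 1) k, JT a (fun i => 2 * (α i : ℤ) - (indS S i : ℤ)) =
      if S.card ≤ k then
        ∑ β ∈ PV (n + 1) (k - S.card), JT a (fun i => 2 * (β i : ℤ) + (indS S i : ℤ)) else 0 := by
  have good : ∀ α : Fin (n + 1) → ℕ, Antitone α →
      JT a (fun i => 2 * (α i : ℤ) - (indS S i : ℤ)) ≠ 0 →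
      (∀ i, indS S i ≤ α i) ∧ Antitone (fun i => α i - indS S i) := by
    intro α hα hne
    have hle1 : ∀ i, indS S i ≤ 1 := fun i => by unfold indS; split_ifs <;> simp
    have hanti : Antitone (fun i => (α i : ℤ) - (indS S i : ℤ)) := by
      rw [Fin.antitone_iff_succ_le]
      intro i
      by_contra hlt
      push Not at hlt
      apply hne
      apply JT_zero_adj a _ i
      have h0 := hα (Fin.castSucc_lt_succ (i := i)).le
      have h1 := hle1 i.castSucc
      have h2 := hle1 i.succ
      omega
    have hlast : indS S (Fin.last n) ≤ α (Fin.last n) := by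
      by_contra hlt
      push Not at hlt
      apply hne
      apply JT_zero_last a ha
      have h1 := hle1 (Fin.last n)
      omega
    have hall : ∀ i, indS S i ≤ α i := by
      intro i
      have : (α (Fin.last n) : ℤ) - (indS S (Fin.last n) : ℤ) ≤ (α i : ℤ) - (indS S i : ℤ) :=
        hanti (Fin.le_last i)
      omega
    refine ⟨hall, fun i j hij => ?_⟩
    have h1 : (α j : ℤ) - (indS S j : ℤ) ≤ (α i : ℤ) - (indS S i : ℤ) := hanti hij
    change α j - indS S j ≤ α i - indS S i
    have h2 := hall i
    have h3 := hall j
    omega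
  have good' : ∀ β : Fin (n + 1) → ℕ, Antitone β →
      JT a (fun i => 2 * (β i : ℤ) + (indS S i : ℤ)) ≠ 0 →
      Antitone (fun i => β i + indS S i) := by
    intro α hα hne
    have hle1 : ∀ i, indS S i ≤ 1 := fun i => by unfold indS; split_ifs <;> simp
    rw [Fin.antitone_iff_succ_le]
    intro i
    by_contra hlt
    push Not at hlt
    apply hne
    apply JT_zero_adj a _ i
    have h0 := hα (Fin.castSucc_lt_succ (i := i)).le
    have h1 := hle1 i.castSucc
    have h2 := hle1 i.succ
    omega
  have hsum : ∀ α : Fin (n + 1) → ℕ, (∀ i, indS S i ≤ α i) →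
      ∑ i, (α i - indS S i) + S.card = ∑ i, α i := by
    intro α h
    rw [← indS_sum S, ← Finset.sum_add_distrib]
    exact Finset.sum_congr rfl fun i _ => Nat.sub_add_cancel (h i)
  split_ifs with hk
  · refine Finset.sum_bij_ne_zero (fun α _ _ i => α i - indS S i) ?_ ?_ ?_ ?_
    · intro α h1 h2
      rw [mem_PV] at h1
      obtain ⟨g1, g2⟩ := good α h1.2 h2
      rw [mem_PV]
      refine ⟨?_, g2⟩
      have := hsum α g1
      omega
    · intro α h1 h2 α' h1' h2' heq
      rw [mem_PV] at h1 h1'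
      obtain ⟨g1, -⟩ := good α h1.2 h2
      obtain ⟨g1', -⟩ := good α' h1'.2 h2'
      funext i
      have := congrFun heq i
      have := g1 i
      have := g1' i
      omega
    · intro β h1 h2
      rw [mem_PV] at h1
      refine ⟨fun i => β i + indS S i, ?_, ?_, ?_⟩
      · rw [mem_PV]
        refine ⟨?_, good' β h1.2 h2⟩
        rw [Finset.sum_add_distrib, indS_sum]
        omega
      · convert h2 using 3
        push_cast
        ring
      · funext i; simp
    · intro α h1 h2
      rw [mem_PV] at h1
      obtain ⟨g1, g2⟩ := good α h1.2 h2
      congr 1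
      funext i
      have := g1 i
      change 2 * (α i : ℤ) - (indS S i : ℤ) = 2 * ((α i - indS S i : ℕ) : ℤ) + (indS S i : ℤ)
      omega
  · refine Finset.sum_eq_zero fun α h1 => ?_
    by_contra h2
    rw [mem_PV] at h1
    obtain ⟨g1, g2⟩ := good α h1.2 h2
    have := hsum α g1
    omega

lemma G_step {R : Type*} [CommRing R] (a : ℤ → R) (e : ℕ → R) (ha : ∀ m < 0, a m = 0)
    (he0 : e 0 = 1)
    (hrec : ∀ m : ℕ, a (m + 1) = ∑ c ∈ range (m + 1), (-1) ^ c * e (c + 1) * a (m - c))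
    (u : R) (k n : ℕ) (hn : 2 * k ≤ n + 1) :
    ∑ α ∈ PV (n + 1) k, JT (fun m => a m + u * a (m - 1)) (fun i => 2 * (α i : ℤ)) =
      ∑ j ∈ range (k + 1), u ^ j * e j *
        ∑ β ∈ PV (n + 1) (k - j), JT a (fun i => 2 * (β i : ℤ)) := by
  simp only [JT_skew]
  rw [Finset.sum_comm]
  simp only [← Finset.mul_sum, bij_S a ha]
  have h1 : ∀ j ∈ range (k + 1), u ^ j * e j *
        ∑ β ∈ PV (n + 1) (k - j), JT a (fun i => 2 * (β i : ℤ)) =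
      ∑ S ∈ (Finset.univ : Finset (Finset (Fin (n + 1)))) with S.card = j,
        u ^ S.card * (if S.card ≤ k then
          ∑ β ∈ PV (n + 1) (k - S.card), JT a (fun i => 2 * (β i : ℤ) + (indS S i : ℤ)) else 0) := by
    intro j hj
    rw [Finset.mem_range] at hj
    have h2 : ∀ S ∈ (Finset.univ : Finset (Finset (Fin (n + 1)))).filter (fun S => S.card = j),
        u ^ S.card * (if S.card ≤ k then
          ∑ β ∈ PV (n + 1) (k - S.card), JT a (fun i => 2 * (β i : ℤ) + (indS S i : ℤ)) else 0) =
        ∑ β ∈ PV (n + 1) (k - j), u ^ j * JT a (fun i => 2 * (β i : ℤ) + (indS S i : ℤ)) := by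
      intro S hS
      rw [Finset.mem_filter] at hS
      rw [hS.2, if_pos (by omega), Finset.mul_sum]
    rw [Finset.sum_congr rfl h2, Finset.sum_comm, Finset.mul_sum]
    refine Finset.sum_congr rfl fun β hβ => ?_
    rw [mem_PV] at hβ
    rw [← Finset.mul_sum, mul_assoc]
    congr 1
    have := pieri a e ha he0 hrec (fun i => 2 * β i) j (by
      rw [← Finset.mul_sum, hβ.1]; omega)
    push_cast at this
    exact this.symm
  rw [Finset.sum_congr rfl h1]
  rw [← Finset.sum_fiberwise_of_maps_to (s := (Finset.univ : Finset (Finset (Fin (n + 1)))))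
    (t := range (n + 2)) (g := Finset.card)]
  · have hz : ∀ j, ¬ j ≤ k → ∑ S ∈ (Finset.univ : Finset (Finset (Fin (n + 1)))) with S.card = j,
        u ^ S.card * (if S.card ≤ k then
          ∑ β ∈ PV (n + 1) (k - S.card), JT a (fun i => 2 * (β i : ℤ) + (indS S i : ℤ)) else 0) = 0 := by
      intro j hj
      refine Finset.sum_eq_zero fun S hS => ?_
      rw [Finset.mem_filter] at hS
      rw [if_neg (by omega), mul_zero]
    symm
    apply Finset.sum_subset
    · intro j; simp only [Finset.mem_range]; omega
    · intro j _ hj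
      apply hz
      simp only [Finset.mem_range] at hj
      omega
  · intro S _
    rw [Finset.mem_range]
    have := Finset.card_le_univ S
    simp at this
    omega

end PartTwo

section PartThree

variable {R : Type*} [CommRing R] [Algebra ℚ R]

lemma hh_neg (n : ℤ) (h : n < 0) : hh n = 0 := by simp [hh, h]
lemma hh_zero : hh 0 = 1 := by simp [hh]
lemma hh_succ (n : ℕ) : hh ((n : ℤ) + 1) = MvPolynomial.X n := by
  have h1 : ¬ ((n : ℤ) + 1 < 0) := by omega
  have h2 : ¬ ((n : ℤ) + 1 = 0) := by omega
  have h3 : ((n : ℤ) + 1).toNat - 1 = n := by omega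
  simp only [hh, h1, h2, h3, if_false]

lemma adams_h2 (i : ℕ) : adams i (hh 2) = (2⁻¹ : ℚ) • (pp i * pp i + pp (2 * i)) := by
  have h2 : hh 2 = MvPolynomial.X 1 := by
    have := hh_succ 1
    norm_num at this
    exact this
  have e1 : hInP 1 = MvPolynomial.X 0 := by
    rw [hInP]; simp [hInP]
  have e2 : hInP 2 = (2⁻¹ : ℚ) • (MvPolynomial.X 0 * MvPolynomial.X 0 + MvPolynomial.X 1) := by
    rw [hInP]; simp [Finset.sum_range_succ, e1, hInP]; norm_num
  rw [h2, adams, MvPolynomial.aeval_X, e2]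
  simp [mul_comm 2 i]

/-- Euler operator. -/
noncomputable def theta (f : PowerSeries R) : PowerSeries R :=
  PowerSeries.X * PowerSeries.derivative R f

lemma theta_mul (f g : PowerSeries R) : theta (f * g) = theta f * g + f * theta g := by
  simp only [theta, Derivation.leibniz, smul_eq_mul]; ring

lemma coeff_theta (f : PowerSeries R) (n : ℕ) :
    PowerSeries.coeff n (theta f) = n * PowerSeries.coeff n f := by
  cases n with
  | zero => simp [theta]
  | succ n =>
    rw [theta, PowerSeries.coeff_succ_X_mul, PowerSeries.coeff_derivative]
    push_cast; ring

lemma theta_rescale (c : R) (f : PowerSeries R) :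
    theta (PowerSeries.rescale c f) = PowerSeries.rescale c (theta f) := by
  ext n
  simp only [coeff_theta, PowerSeries.coeff_rescale]; ring

lemma theta_unique (A f g : PowerSeries R) (hA : PowerSeries.coeff 0 A = 0)
    (hf : theta f = A * f) (hg : theta g = A * g)
    (h0 : PowerSeries.coeff 0 f = PowerSeries.coeff 0 g) : f = g := by
  ext n
  induction n using Nat.strong_induction_on with
  | _ n ih =>
    cases n with
    | zero => exact h0
    | succ n =>
      have h1 := congrArg (PowerSeries.coeff (n + 1)) hf
      have h2 := congrArg (PowerSeries.coeff (n + 1)) hg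
      rw [coeff_theta, PowerSeries.coeff_mul] at h1 h2
      have h3 : ∑ p ∈ Finset.HasAntidiagonal.antidiagonal (n + 1), PowerSeries.coeff p.1 A * PowerSeries.coeff p.2 f
          = ∑ p ∈ Finset.HasAntidiagonal.antidiagonal (n + 1), PowerSeries.coeff p.1 A * PowerSeries.coeff p.2 g := by
        refine Finset.sum_congr rfl fun p hp => ?_
        rw [Finset.HasAntidiagonal.mem_antidiagonal] at hp
        by_cases hp0 : p.1 = 0
        · rw [hp0, hA]; simp
        · rw [ih p.2 (by omega)]
      rw [h3, ← h2] at h1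
      have hu : IsUnit ((n + 1 : ℕ) : R) := by
        have : IsUnit (algebraMap ℚ R ((n + 1 : ℕ) : ℚ)) :=
          (IsUnit.mk0 _ (by positivity)).map _
        rwa [map_natCast] at this
      exact hu.mul_left_cancel h1

/-- generating series -/
noncomputable def serH (ψ : SymFn →ₐ[ℚ] R) : PowerSeries R := PowerSeries.mk fun n => ψ (hh n)
/-- generating series -/
noncomputable def serP (ψ : SymFn →ₐ[ℚ] R) : PowerSeries R := PowerSeries.mk fun n => ψ (pp n)
/-- generating series -/
noncomputable def serE (ψ : SymFn →ₐ[ℚ] R) : PowerSeries R :=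
  PowerSeries.mk fun n => (-1) ^ n * ψ (ee n)
/-- generating series -/
noncomputable def serF (ψ : SymFn →ₐ[ℚ] R) : PowerSeries R :=
  PowerSeries.mk fun n => ψ (hPleth (hh 2) n)
/-- generating series -/
noncomputable def serA (ψ : SymFn →ₐ[ℚ] R) : PowerSeries R :=
  PowerSeries.mk fun n => ψ (adams n (hh 2))

lemma theta_serH (ψ : SymFn →ₐ[ℚ] R) : theta (serH ψ) = serP ψ * serH ψ := by
  ext n
  rw [coeff_theta, mul_comm (serP ψ), PowerSeries.coeff_mul,
    Finset.Nat.sum_antidiagonal_eq_sum_range_succ_mk]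
  simp only [serH, serP, PowerSeries.coeff_mk]
  cases n with
  | zero => simp [pp]
  | succ k =>
    rw [Finset.sum_range_succ', Finset.sum_range_succ]
    simp only [Nat.add_sub_add_right, Nat.sub_self, Nat.sub_zero]
    have h0 : pp 0 = 0 := by rw [pp]
    rw [h0, pp]
    simp only [map_sub, map_sum, map_mul, map_smul, Nat.cast_zero, hh_zero, map_one, map_zero]
    rw [Algebra.smul_def]
    push_cast
    simp

lemma serH_mul_serE (ψ : SymFn →ₐ[ℚ] R) : serH ψ * serE ψ = 1 := by
  ext n
  rw [PowerSeries.coeff_mul, Finset.Nat.sum_antidiagonal_eq_sum_range_succ_mk]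
  simp only [serH, serE, PowerSeries.coeff_mk, PowerSeries.coeff_one]
  cases n with
  | zero => simp [ee, hh_zero]
  | succ k =>
    rw [Finset.sum_range_succ', if_neg (Nat.succ_ne_zero k)]
    simp only [Nat.add_sub_add_right, Nat.sub_zero]
    rw [ee]
    simp only [map_sum, map_smul, map_mul, Nat.cast_zero, hh_zero, map_one, one_mul,
      Finset.mul_sum]
    rw [← Finset.sum_add_distrib]
    refine Finset.sum_eq_zero fun i hi => ?_
    rw [Finset.mem_range] at hi
    obtain ⟨d, rfl⟩ := Nat.exists_eq_add_of_le (Nat.le_of_lt_succ hi)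
    rw [Nat.add_sub_cancel_left, Algebra.smul_def]
    simp only [map_pow, map_neg, map_one]
    have : ((-1 : R)) ^ (i + d + 1) * (-1) ^ i = - (-1) ^ d := by
      rw [show i + d + 1 = i + (d + 1) by ring, pow_add, mul_right_comm, ← pow_add,
        Even.neg_one_pow ⟨i, rfl⟩]
      ring
    push_cast
    rw [← mul_assoc ((-1 : R) ^ (i + d + 1)), this]
    ring

lemma theta_serE (ψ : SymFn →ₐ[ℚ] R) : theta (serE ψ) = - serP ψ * serE ψ := by
  have h := serH_mul_serE ψ
  have h1 : theta (serH ψ * serE ψ) = 0 := by rw [h]; simp [theta]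
  rw [theta_mul, theta_serH] at h1
  have h2 : serE ψ * (serP ψ * serH ψ * serE ψ + serH ψ * theta (serE ψ)) = 0 := by
    rw [h1, mul_zero]
  linear_combination h2 - (theta (serE ψ) + serP ψ * serE ψ) * h

lemma theta_serF (ψ : SymFn →ₐ[ℚ] R) : theta (serF ψ) = serA ψ * serF ψ := by
  ext n
  rw [coeff_theta, PowerSeries.coeff_mul, Finset.Nat.sum_antidiagonal_eq_sum_range_succ_mk]
  simp only [serF, serA, PowerSeries.coeff_mk]
  cases n with
  | zero => simp [adams_h2, pp]
  | succ k =>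
    rw [Finset.sum_range_succ']
    simp only [Nat.add_sub_add_right, Nat.sub_zero]
    have h0 : adams 0 (hh 2) = 0 := by simp [adams_h2, pp]
    rw [h0, hPleth]
    simp only [map_smul, map_sum, map_mul, map_zero, zero_mul, add_zero]
    rw [Algebra.smul_def, ← mul_assoc]
    have : ((k + 1 : ℕ) : R) * algebraMap ℚ R (((k : ℚ) + 1)⁻¹) = 1 := by
      rw [← map_natCast (algebraMap ℚ R), ← map_mul, Nat.cast_add, Nat.cast_one,
        mul_inv_cancel₀ (by positivity), map_one]
    rw [this, one_mul]

lemma rec_a (ψ : SymFn →ₐ[ℚ] R) (m : ℕ) : ψ (hh ((m : ℤ) + 1)) =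
    ∑ c ∈ range (m + 1), (-1) ^ c * ψ (ee (c + 1)) * ψ (hh ((m : ℤ) - c)) := by
  have h := congrArg (PowerSeries.coeff (m + 1)) (serH_mul_serE ψ)
  rw [mul_comm, PowerSeries.coeff_mul, Finset.Nat.sum_antidiagonal_eq_sum_range_succ_mk] at h
  simp only [serH, serE, PowerSeries.coeff_mk, PowerSeries.coeff_one] at h
  rw [Finset.sum_range_succ', if_neg (Nat.succ_ne_zero m)] at h
  simp only [Nat.add_sub_add_right, Nat.sub_zero, pow_zero, one_mul] at h
  have h0 : ee 0 = 1 := by rw [ee]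
  rw [h0, map_one, one_mul] at h
  push_cast at h
  rw [eq_comm, ← sub_eq_zero, ← neg_eq_zero, ← h, neg_sub, sub_eq_add_neg, add_comm,
    ← Finset.sum_neg_distrib]
  congr 1
  refine Finset.sum_congr rfl fun c hc => ?_
  rw [Finset.mem_range] at hc
  rw [Nat.cast_sub (by omega)]
  ring


lemma serH_step (ψ ψ' : SymFn →ₐ[ℚ] R) (u : R)
    (hψ : ∀ n : ℤ, ψ' (hh n) = ψ (hh n) + u * ψ (hh (n - 1))) : serH ψ' = (1 + PowerSeries.C u * PowerSeries.X) * serH ψ := by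
  ext n
  rw [add_mul, one_mul, mul_assoc, map_add, PowerSeries.coeff_C_mul]
  cases n with
  | zero => simp [serH, hψ, hh_neg]
  | succ n =>
    rw [PowerSeries.coeff_succ_X_mul]
    simp [serH, hψ]

lemma serP_step (ψ ψ' : SymFn →ₐ[ℚ] R) (u : R)
    (hψ : ∀ n : ℤ, ψ' (hh n) = ψ (hh n) + u * ψ (hh (n - 1))) : serP ψ' = serP ψ +
    PowerSeries.mk (fun n => if n = 0 then 0 else - (-u) ^ n) := by
  set Q : PowerSeries R := PowerSeries.mk (fun n => if n = 0 then 0 else - (-u) ^ n) with hQ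
  have hQ1 : Q * (1 + PowerSeries.C u * PowerSeries.X) = PowerSeries.C u * PowerSeries.X := by
    ext n
    rw [mul_add, mul_one, mul_left_comm, map_add, PowerSeries.coeff_C_mul,
      PowerSeries.coeff_C_mul]
    cases n with
    | zero => simp [hQ]
    | succ n =>
      rw [PowerSeries.coeff_succ_mul_X, PowerSeries.coeff_X]
      cases n with
      | zero => simp [hQ]
      | succ n => simp [hQ]; ring
  have hth : theta (1 + PowerSeries.C u * PowerSeries.X : PowerSeries R) =
      PowerSeries.C u * PowerSeries.X := by
    ext n
    rw [coeff_theta]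
    rcases n with _ | _ | n
    · simp
    · simp [PowerSeries.coeff_one]
    · simp [PowerSeries.coeff_one, PowerSeries.coeff_X]
  have h1 := theta_serH ψ'
  rw [serH_step ψ ψ' u hψ, theta_mul, theta_serH, hth] at h1
  have h2 := serH_mul_serE ψ'
  rw [serH_step ψ ψ' u hψ] at h2
  linear_combination (-serE ψ') * h1 - serE ψ' * serH ψ * hQ1 -
    (serP ψ' - serP ψ - Q) * h2

lemma pp_step (ψ ψ' : SymFn →ₐ[ℚ] R) (u : R)
    (hψ : ∀ n : ℤ, ψ' (hh n) = ψ (hh n) + u * ψ (hh (n - 1))) (n : ℕ) : ψ' (pp n) = ψ (pp n) + if n = 0 then 0 else - (-u) ^ n := by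
  have := congrArg (PowerSeries.coeff n) (serP_step ψ ψ' u hψ)
  simpa [serP] using this

lemma serA_step (ψ ψ' : SymFn →ₐ[ℚ] R) (u : R)
    (hψ : ∀ n : ℤ, ψ' (hh n) = ψ (hh n) + u * ψ (hh (n - 1))) : serA ψ' = serA ψ - PowerSeries.rescale (-u) (serP ψ) := by
  ext n
  simp only [serA, serP, map_sub, PowerSeries.coeff_rescale, PowerSeries.coeff_mk, adams_h2,
    map_smul, map_add, map_mul, pp_step ψ ψ' u hψ]
  by_cases hn : n = 0
  · subst hn; simp [pp]
  · have h2 : 2 * n ≠ 0 := by omega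
    rw [if_neg hn, if_neg h2, pow_mul', Algebra.smul_def, Algebra.smul_def]
    have : algebraMap ℚ R 2⁻¹ * 2 = 1 := by
      have : (2 : R) = algebraMap ℚ R 2 := (map_ofNat _ 2).symm
      rw [this, ← map_mul]; norm_num
    linear_combination (-(-u) ^ n * ψ (pp n)) * this

lemma serF_step (ψ ψ' : SymFn →ₐ[ℚ] R) (u : R)
    (hψ : ∀ n : ℤ, ψ' (hh n) = ψ (hh n) + u * ψ (hh (n - 1))) : serF ψ' = serF ψ * PowerSeries.rescale (-u) (serE ψ) := by
  refine theta_unique (serA ψ') _ _ ?_ (theta_serF ψ') ?_ ?_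
  · simp [serA, adams_h2, pp]
  · rw [theta_mul, theta_rescale, theta_serE, theta_serF, serA_step ψ ψ' u hψ]
    simp only [map_mul, map_neg]
    ring
  · rw [PowerSeries.coeff_mul]
    simp [serF, serE, hPleth, ee, -PowerSeries.coeff_zero_eq_constantCoeff]

lemma F_step (ψ ψ' : SymFn →ₐ[ℚ] R) (u : R)
    (hψ : ∀ n : ℤ, ψ' (hh n) = ψ (hh n) + u * ψ (hh (n - 1))) (k : ℕ) : ψ' (hPleth (hh 2) k) =
    ∑ j ∈ range (k + 1), u ^ j * ψ (ee j) * ψ (hPleth (hh 2) (k - j)) := by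
  have h := congrArg (PowerSeries.coeff k) (serF_step ψ ψ' u hψ)
  rw [mul_comm, PowerSeries.coeff_mul, Finset.Nat.sum_antidiagonal_eq_sum_range_succ_mk] at h
  simp only [serF, serE, PowerSeries.coeff_rescale, PowerSeries.coeff_mk] at h
  rw [h]
  refine Finset.sum_congr rfl fun j _ => ?_
  rw [← mul_assoc, ← mul_pow]
  simp


end PartThree

section PartFour

lemma JT_pad {R : Type*} [CommRing R] (a : ℤ → R) (ha : ∀ m < 0, a m = 0) (ha0 : a 0 = 1)
    (g : ℕ → ℤ) (m n : ℕ) (hmn : m ≤ n) (hg : ∀ i, m ≤ i → g i = 0) :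
    JT a (fun i : Fin n => g i) = JT a (fun i : Fin m => g i) := by
  induction n, hmn using Nat.le_induction with
  | base => rfl
  | succ n hn ih =>
    rw [← ih]
    unfold JT
    rw [Matrix.det_succ_row _ (Fin.last n), Finset.sum_eq_single (Fin.last n)]
    · have h1 : ((-1 : R)) ^ (n + n) = 1 := Even.neg_one_pow ⟨n, rfl⟩
      simp only [Fin.val_last, h1, Matrix.of_apply, hg n hn, Fin.succAbove_last]
      simp only [zero_add, sub_self, ha0, one_mul]
      congr 1
    · intro j _ hj
      have hj' : j.val < n := by
        have := j.2
        have h3 : j.val ≠ n := fun h => hj (Fin.ext h)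
        omega
      simp only [Matrix.of_apply, Fin.val_last, hg n hn]
      rw [ha (0 + (j.val : ℤ) - n) (by omega)]
      simp
    · simp

lemma sortedParts_double (m : Multiset ℕ) :
    sortedParts (double m) = (sortedParts m).map (2 * ·) := by
  unfold sortedParts double
  rw [List.map_reverse, Multiset.map_sort (fun x => 2 * x) m (· ≤ ·) (· ≤ ·)]
  intro a _ b _
  simp

lemma sortedParts_coe (m : Multiset ℕ) : ((sortedParts m : List ℕ) : Multiset ℕ) = m := by
  unfold sortedParts
  rw [← Multiset.coe_reverse, List.reverse_reverse, Multiset.sort_eq]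

lemma sortedParts_length (m : Multiset ℕ) : (sortedParts m).length = Multiset.card m := by
  simp [sortedParts]

lemma sortedParts_pairwise (m : Multiset ℕ) : (sortedParts m).Pairwise (· ≥ ·) := by
  unfold sortedParts
  rw [List.pairwise_reverse]
  exact Multiset.pairwise_sort m _

lemma ofFn_getD (l : List ℕ) (n : ℕ) (h : l.length ≤ n) :
    List.ofFn (fun i : Fin n => l.getD i 0) = l ++ List.replicate (n - l.length) 0 := by
  apply List.ext_getElem
  · simp; omega
  · intro i h1 h2
    simp only [List.getElem_ofFn]
    by_cases hi : i < l.length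
    · rw [List.getElem_append_left hi, List.getD_eq_getElem _ _ hi]
    · rw [List.getElem_append_right (by omega), List.getD_eq_default _ _ (by omega)]
      simp

/-- vector of a multiset -/
def vecOf (n : ℕ) (m : Multiset ℕ) (i : Fin n) : ℕ := (sortedParts m).getD i 0

lemma vecOf_multiset (n : ℕ) (m : Multiset ℕ) (h : Multiset.card m ≤ n) :
    ((List.ofFn (vecOf n m) : List ℕ) : Multiset ℕ) =
      m + Multiset.replicate (n - Multiset.card m) 0 := by
  have h1 := ofFn_getD (sortedParts m) n (by rw [sortedParts_length]; exact h)
  have h2 : vecOf n m = fun i : Fin n => (sortedParts m).getD i 0 := rfl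
  rw [h2, h1, ← Multiset.coe_add, sortedParts_coe, sortedParts_length]
  rfl

lemma vecOf_sorted (n : ℕ) (m : Multiset ℕ) (h : Multiset.card m ≤ n) :
    (List.ofFn (vecOf n m)).Pairwise (· ≥ ·) := by
  have h1 := ofFn_getD (sortedParts m) n (by rw [sortedParts_length]; exact h)
  have h2 : vecOf n m = fun i : Fin n => (sortedParts m).getD i 0 := rfl
  rw [h2, h1, List.pairwise_append]
  refine ⟨sortedParts_pairwise m, ?_, ?_⟩
  · rw [List.pairwise_replicate]; simp
  · intro a _ b hb
    rw [List.eq_of_mem_replicate hb]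
    exact Nat.zero_le _

lemma ofFn_pairwise_iff {n : ℕ} (v : Fin n → ℕ) :
    (List.ofFn v).Pairwise (· ≥ ·) ↔ Antitone v := by
  rw [List.pairwise_ofFn]
  constructor
  · intro h i j hij
    rcases hij.lt_or_eq with h1 | h1
    · exact h h1
    · rw [h1]
  · intro h i j hij
    exact h hij.le

lemma part_card_le {k : ℕ} (α : Nat.Partition k) : Multiset.card α.parts ≤ k := by
  have h := Multiset.card_nsmul_le_sum (s := α.parts) (a := 1) (fun x hx => α.parts_pos hx)
  rw [α.parts_sum] at h
  simpa using h

lemma sum_partition {M : Type*} [AddCommMonoid M] (k n : ℕ) (hkn : k ≤ n) (f : (Fin n → ℕ) → M) :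
    ∑ α : Nat.Partition k, f (vecOf n α.parts) = ∑ v ∈ PV n k, f v := by
  refine Finset.sum_bij (fun α _ => vecOf n α.parts) ?_ ?_ ?_ ?_
  · intro α _
    have hc := (part_card_le α).trans hkn
    rw [mem_PV]
    constructor
    · have h := congrArg Multiset.sum (vecOf_multiset n α.parts hc)
      rw [Multiset.sum_coe, List.sum_ofFn] at h
      rw [h]
      simp [α.parts_sum]
    · rw [← ofFn_pairwise_iff]
      exact vecOf_sorted n _ hc
  · intro α _ β _ h
    have h1 := vecOf_multiset n α.parts ((part_card_le α).trans hkn)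
    have h2 := vecOf_multiset n β.parts ((part_card_le β).trans hkn)
    rw [h, h2] at h1
    have h3 := congrArg (Multiset.filter (fun x => x ≠ 0)) h1
    have hz : ∀ j : ℕ, Multiset.filter (fun x : ℕ => x ≠ 0) (Multiset.replicate j 0) = 0 := by
      intro j
      rw [Multiset.filter_eq_nil]
      intro a ha
      simp [Multiset.eq_of_mem_replicate ha]
    have hp : ∀ γ : Nat.Partition k, Multiset.filter (fun x : ℕ => x ≠ 0) γ.parts = γ.parts := by
      intro γ
      rw [Multiset.filter_eq_self]
      intro a ha
      exact (γ.parts_pos ha).ne'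
    rw [Multiset.filter_add, Multiset.filter_add, hz, hz, hp, hp, add_zero, add_zero] at h3
    exact Nat.Partition.ext h3.symm
  · intro v hv
    rw [mem_PV] at hv
    let s : Multiset ℕ := (List.ofFn v : List ℕ)
    have hs : s.sum = k := by
      simp only [s, Multiset.sum_coe, List.sum_ofFn]; exact hv.1
    have hsc : Multiset.card s = n := by simp [s]
    have hsplit : s.filter (fun x => x ≠ 0) + Multiset.replicate (s.count 0) 0 = s := by
      conv_rhs => rw [← Multiset.filter_add_not (fun x => x ≠ 0) s]
      congr 1
      rw [← Multiset.filter_eq']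
      congr 1
      funext x; simp
    refine ⟨⟨s.filter (fun x => x ≠ 0), ?_, ?_⟩, Finset.mem_univ _, ?_⟩
    · intro i hi
      exact Nat.pos_of_ne_zero (Multiset.mem_filter.1 hi).2
    · have := congrArg Multiset.sum hsplit
      simpa [hs] using this
    · have hcs := congrArg Multiset.card hsplit
      rw [Multiset.card_add, Multiset.card_replicate, hsc] at hcs
      have hc : Multiset.card (s.filter (fun x => x ≠ 0)) ≤ n := by omega
      have h1 := vecOf_multiset n (s.filter (fun x => x ≠ 0)) hc
      rw [show n - Multiset.card (s.filter (fun x => x ≠ 0)) = s.count 0 by omega, hsplit] at h1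
      have h2 := (Multiset.coe_eq_coe.1 h1).eq_of_pairwise
        (fun a b _ _ h h' => le_antisymm h' h) (vecOf_sorted n _ hc) ((ofFn_pairwise_iff v).2 hv.2)
      exact List.ofFn_injective h2
  · intro α _
    rfl

/-- the right-hand side -/
noncomputable def GG (k : ℕ) : SymFn := ∑ α : Nat.Partition k, schur (double α.parts)

lemma GG_eq (k n : ℕ) (hkn : k ≤ n) :
    GG k = ∑ v ∈ PV n k, JT hh (fun i => 2 * (v i : ℤ)) := by
  rw [← sum_partition k n hkn (fun v => JT hh (fun i => 2 * (v i : ℤ)))]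
  unfold GG
  refine Finset.sum_congr rfl fun α _ => ?_
  have hc : Multiset.card (double α.parts) ≤ n := by
    simp only [double, Multiset.card_map]
    exact (part_card_le α).trans hkn
  have h := JT_pad hh hh_neg hh_zero (fun i => (((sortedParts (double α.parts)).getD i 0 : ℕ) : ℤ))
    (Multiset.card (double α.parts)) n hc (by
      intro i hi
      rw [List.getD_eq_default _ _ (by rw [sortedParts_length]; exact hi)]
      rfl)
  refine Eq.trans h.symm ?_
  congr 1
  funext i
  rw [sortedParts_double]
  have : (List.map (fun x => 2 * x) (sortedParts α.parts)).getD i 0 =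
      2 * (sortedParts α.parts).getD i 0 := by
    have := List.getD_map (l := sortedParts α.parts) (n := i.val) (d := 0) (fun x : ℕ => 2 * x)
    simpa using this
  rw [this]
  push_cast
  rfl

lemma map_JT {R S : Type*} [CommRing R] [CommRing S] (f : R →+* S) (a : ℤ → R) {n : ℕ}
    (l : Fin n → ℤ) : f (JT a l) = JT (fun m => f (a m)) l := by
  unfold JT
  rw [RingHom.map_det]
  rfl

/-- specialization `h_n ↦ e_n(t)` -/
noncomputable def spec {R : Type*} [CommRing R] [Algebra ℚ R] (s : Multiset R) : SymFn →ₐ[ℚ] R :=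
  MvPolynomial.aeval fun n => s.esymm (n + 1)

lemma esymm_cons' {R : Type*} [CommRing R] (u : R) (s : Multiset R) (n : ℕ) :
    (u ::ₘ s).esymm (n + 1) = s.esymm (n + 1) + u * s.esymm n := by
  simp [Multiset.esymm, Multiset.powersetCard_cons, Multiset.map_add, Multiset.map_map,
    Multiset.sum_map_mul_left]

lemma spec_cons {R : Type*} [CommRing R] [Algebra ℚ R] (u : R) (s : Multiset R) (n : ℤ) :
    spec (u ::ₘ s) (hh n) = spec s (hh n) + u * spec s (hh (n - 1)) := by
  rcases lt_trichotomy n 0 with h | h | h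
  · rw [hh_neg n h, hh_neg (n - 1) (by omega)]; simp
  · subst h; rw [hh_zero, hh_neg (0 - 1) (by omega)]; simp
  · obtain ⟨m, rfl⟩ : ∃ m : ℕ, n = (m : ℤ) + 1 := ⟨(n - 1).toNat, by omega⟩
    rw [hh_succ, add_sub_cancel_right]
    cases m with
    | zero =>
      simp [spec, hh_zero, esymm_cons', Multiset.esymm]
    | succ m =>
      push_cast
      rw [hh_succ]
      simp [spec, esymm_cons']

lemma hPleth_zero : hPleth (hh 2) 0 = 1 := by rw [hPleth]

lemma GG_zero : GG 0 = 1 := by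
  unfold GG
  rw [Fintype.sum_unique]
  have : (default : Nat.Partition 0).parts = 0 := by
    rw [← Multiset.card_eq_zero]
    exact Nat.le_zero.1 (part_card_le _)
  rw [this]
  unfold schur double
  simp only [Multiset.map_zero]
  have : IsEmpty (Fin (Multiset.card (0 : Multiset ℕ))) := by
    rw [Multiset.card_zero]; infer_instance
  exact Matrix.det_isEmpty

lemma spec_nil_hh {R : Type*} [CommRing R] [Algebra ℚ R] (n : ℤ) (hn : n ≠ 0) :
    spec (0 : Multiset R) (hh n) = 0 := by
  rcases lt_or_gt_of_ne hn with h | h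
  · rw [hh_neg n h, map_zero]
  · obtain ⟨m, rfl⟩ : ∃ m : ℕ, n = (m : ℤ) + 1 := ⟨(n - 1).toNat, by omega⟩
    rw [hh_succ]
    simp [spec, Multiset.esymm, Multiset.powersetCard_zero_right]

lemma spec_nil {R : Type*} [CommRing R] [Algebra ℚ R] (k : ℕ) :
    spec (0 : Multiset R) (hPleth (hh 2) k) = spec (0 : Multiset R) (GG k) := by
  rcases Nat.eq_zero_or_pos k with rfl | hk
  · rw [hPleth_zero, GG_zero]
  · have hH : serH (spec (0 : Multiset R)) = 1 := by
      ext n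
      rw [serH, PowerSeries.coeff_mk, PowerSeries.coeff_one]
      split_ifs with h
      · subst h; simp [hh_zero]
      · exact spec_nil_hh _ (by exact_mod_cast h)
    have hP : serP (spec (0 : Multiset R)) = 0 := by
      have := theta_serH (spec (0 : Multiset R))
      rw [hH, mul_one] at this
      rw [← this]; simp [theta]
    have hp : ∀ n, spec (0 : Multiset R) (pp n) = 0 := by
      intro n
      have := congrArg (PowerSeries.coeff n) hP
      simpa [serP] using this
    have hA : serA (spec (0 : Multiset R)) = 0 := by
      ext n
      simp [serA, adams_h2, hp]
    have hF : serF (spec (0 : Multiset R)) = 1 := by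
      refine theta_unique 0 _ _ (by simp) ?_ ?_ ?_
      · rw [theta_serF, hA]
      · simp [theta]
      · simp [serF, hPleth_zero]
    have h1 := congrArg (PowerSeries.coeff k) hF
    rw [serF, PowerSeries.coeff_mk, PowerSeries.coeff_one, if_neg hk.ne'] at h1
    rw [h1, GG_eq k (k + 1) (by omega), map_sum]
    symm
    refine Finset.sum_eq_zero fun v hv => ?_
    rw [mem_PV] at hv
    have hv0 : v 0 ≠ 0 := by
      intro h0
      have : ∑ i, v i = 0 := Finset.sum_eq_zero fun i _ => by
        have := hv.2 (Fin.zero_le i)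
        omega
      omega
    have := map_JT (spec (0 : Multiset R)).toRingHom hh (fun i => 2 * (v i : ℤ))
    refine this.trans ?_
    refine Matrix.det_eq_zero_of_row_eq_zero 0 fun j => ?_
    simp only [Matrix.of_apply]
    apply spec_nil_hh
    simp only [Fin.val_zero]
    omega

lemma spec_eq {R : Type*} [CommRing R] [Algebra ℚ R] (s : Multiset R) :
    ∀ k : ℕ, spec s (hPleth (hh 2) k) = spec s (GG k) := by
  induction s using Multiset.induction_on with
  | empty => exact spec_nil
  | cons u s ih =>
    intro k
    rw [F_step (spec s) (spec (u ::ₘ s)) u (spec_cons u s) k]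
    have hG : ∀ (t : Multiset R) (j : ℕ), j ≤ k → spec t (GG j) =
        ∑ v ∈ PV (2 * k + 1) j, JT (fun m => spec t (hh m)) (fun i => 2 * (v i : ℤ)) := by
      intro t j hj
      rw [GG_eq j (2 * k + 1) (by omega), map_sum]
      exact Finset.sum_congr rfl fun v _ => map_JT (spec t).toRingHom hh _
    rw [hG _ k le_rfl]
    simp only [spec_cons]
    rw [G_step (fun m => spec s (hh m)) (fun j => spec s (ee j))
      (fun m hm => by simp only [hh_neg m hm, map_zero]) (by simp [ee])
      (fun m => rec_a (spec s) m) u k (2 * k) (by omega)]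
    refine Finset.sum_congr rfl fun j _ => ?_
    rw [ih, hG s (k - j) (by omega)]

lemma spec_separates (f : SymFn)
    (h : ∀ M : ℕ, spec ((Finset.univ : Finset (Fin M)).val.map
      (MvPolynomial.X : Fin M → MvPolynomial (Fin M) ℚ)) f = 0) : f = 0 := by
  obtain ⟨M, hM⟩ : ∃ M : ℕ, ∀ i ∈ f.vars, i < M := by
    refine ⟨f.vars.sup id + 1, fun i hi => ?_⟩
    exact Nat.lt_succ_of_le (Finset.le_sup (f := id) hi)
  obtain ⟨g, hg⟩ : ∃ g : MvPolynomial (Fin M) ℚ, MvPolynomial.rename (fun i : Fin M => i.val) g = f := by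
    refine MvPolynomial.exists_rename_eq_of_vars_subset_range f _ Fin.val_injective ?_
    intro i hi
    exact ⟨⟨i, hM i hi⟩, rfl⟩
  have h1 := h M
  rw [← hg, spec, MvPolynomial.aeval_rename, ← MvPolynomial.esymm_eq_multiset_esymm] at h1
  have h2 : MvPolynomial.esymmAlgHom (Fin M) ℚ M g = 0 := by
    apply Subtype.ext
    rw [ZeroMemClass.coe_zero, ← h1, MvPolynomial.esymmAlgHom]
    have h3 := MvPolynomial.comp_aeval_apply (R := ℚ)
      (f := fun i : Fin M => (⟨MvPolynomial.esymm (Fin M) ℚ (i + 1),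
        MvPolynomial.esymm_isSymmetric (Fin M) ℚ _⟩ : MvPolynomial.symmetricSubalgebra (Fin M) ℚ))
      (MvPolynomial.symmetricSubalgebra (Fin M) ℚ).val g
    exact h3
  have h4 : g = 0 := by
    apply MvPolynomial.esymmAlgHom_fin_injective ℚ (le_refl M)
    rw [h2, map_zero]
  rw [← hg, h4, map_zero]

end PartFour

/-- `h_k ∘ h₂ = ∑_{α ⊢ k} s_{2α}`. -/
theorem hk_pleth_h2 (k : ℕ) :
    pleth (hh k) (hh 2) = ∑ α : Nat.Partition k, schur (double α.parts) := by
  have h1 : pleth (hh k) (hh 2) = hPleth (hh 2) k := by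
    cases k with
    | zero => simp [pleth, hh_zero, hPleth_zero]
    | succ k =>
      push_cast
      rw [pleth, hh_succ, MvPolynomial.aeval_X]
  rw [h1]
  change hPleth (hh 2) k = GG k
  rw [← sub_eq_zero]
  apply spec_separates
  intro M
  rw [map_sub, spec_eq, sub_self]
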